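/- For every ε>0, the probability that the Erdős–Rényi random graph G ~ G(n,1/2) admits a bisection of its vertex set in which at least (1−ε)n vertices are friendly tends to 1 as n → ∞. -/

import Mathlib

open Finset Filter

open scoped Classical

/-- The number of neighbours of `v` (in the graph `G`) lying in the set `S`. -/
noncomputable def degIn {n : ℕ} (G : SimpleGraph (Fin n)) (S : Finset (Fin n)) (v : Fin n) : ℕ :=
  (S.filter fun w => G.Adj v w).card

/-- The friendliness of a vertex `v` with respect to the bisection `A ∪ Aᶜ`:
the number of neighbours in its own part minus the number of neighbours across. -/
noncomputable def friendliness {n : ℕ} (G : SimpleGraph (Fin n)) (A : Finset (Fin n))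
    (v : Fin n) : ℤ :=
  if v ∈ A then (degIn G A v : ℤ) - (degIn G Aᶜ v : ℤ)
  else (degIn G Aᶜ v : ℤ) - (degIn G A v : ℤ)

/-- `A ∪ Aᶜ` is a bisection: the parts' sizes differ by at most one. -/
def IsBisection {n : ℕ} (A : Finset (Fin n)) : Prop :=
  |(A.card : ℤ) - (Aᶜ.card : ℤ)| ≤ 1

/-- The probability, under the uniform measure on simple graphs on `Fin n`
(i.e. the Erdős–Rényi measure `G(n,1/2)`), of the set of graphs satisfying `P`. -/
noncomputable def graphProb (n : ℕ) (P : SimpleGraph (Fin n) → Prop) : ℝ :=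
  ((univ.filter P).card : ℝ) / (Fintype.card (SimpleGraph (Fin n)) : ℝ)

section SignVectors

variable {ι : Type*} [Fintype ι] [DecidableEq ι]

/-- Flipping the sign of one coordinate does not change a sum over all sign vectors. -/
theorem sum_signs_flip {M : Type*} [AddCommMonoid M] (i : ι) (f : (ι → ℤˣ) → M) :
    ∑ b : ι → ℤˣ, f (b * Pi.mulSingle i (-1)) = ∑ b, f b :=
  Equiv.sum_comp (Equiv.mulRight (Pi.mulSingle i (-1) : ι → ℤˣ)) f

omit [Fintype ι] in
theorem flip_apply_self (i : ι) (b : ι → ℤˣ) :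
    (b * Pi.mulSingle i (-1) : ι → ℤˣ) i = -b i := by simp

omit [Fintype ι] in
theorem flip_apply_of_mem {i : ι} {F : Finset ι} (hi : i ∉ F) {u : ι} (hu : u ∈ F)
    (b : ι → ℤˣ) : (b * Pi.mulSingle i (-1) : ι → ℤˣ) u = b u := by
  have : u ≠ i := fun h => hi (h ▸ hu)
  simp [this]

theorem card_signs : Fintype.card (ι → ℤˣ) = 2 ^ Fintype.card ι := by simp

theorem sum_sq_signs (F : Finset ι) :
    ∑ b : ι → ℤˣ, (∑ i ∈ F, (b i : ℤ)) ^ 2 = #F * 2 ^ Fintype.card ι := by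
  induction F using Finset.induction_on with
  | empty => simp
  | insert i F hi ih =>
    have h := sum_signs_flip i fun b : ι → ℤˣ => (∑ u ∈ insert i F, (b u : ℤ)) ^ 2
    have hflip : ∀ b : ι → ℤˣ,
        ∑ u ∈ F, (((b * Pi.mulSingle i (-1) : ι → ℤˣ) u : ℤˣ) : ℤ) = ∑ u ∈ F, (b u : ℤ) :=
      fun b => sum_congr rfl fun u hu => by rw [flip_apply_of_mem hi hu]
    simp only [sum_insert hi, flip_apply_self, hflip] at h ⊢
    have h2 : ∑ b : ι → ℤˣ, (((-b i : ℤˣ) : ℤ) + ∑ u ∈ F, (b u : ℤ)) ^ 2 +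
        ∑ b : ι → ℤˣ, ((b i : ℤ) + ∑ u ∈ F, (b u : ℤ)) ^ 2 =
        ∑ b : ι → ℤˣ, (2 * (∑ u ∈ F, (b u : ℤ)) ^ 2 + 2) := by
      rw [← sum_add_distrib]
      refine sum_congr rfl fun b _ => ?_
      rcases Int.units_eq_one_or (b i) with hb | hb <;> simp [hb] <;> ring
    rw [h, sum_add_distrib, ← mul_sum, ih] at h2
    simp only [sum_const, card_univ, card_signs, nsmul_eq_mul] at h2
    rw [card_insert_of_notMem hi]
    push_cast at h2 ⊢
    linarith

/-- Chebyshev's inequality for a sum of independent uniform signs. -/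
theorem card_signs_sum_ge (F : Finset ι) {t : ℝ} (ht : 0 < t) :
    (#{b : ι → ℤˣ | t ≤ |((∑ i ∈ F, (b i : ℤ) : ℤ) : ℝ)|} : ℝ) ≤
      #F / t ^ 2 * Fintype.card (ι → ℤˣ) := by
  rw [div_mul_eq_mul_div, le_div_iff₀ (by positivity)]
  have h : ∑ b : ι → ℤˣ, ((∑ i ∈ F, (b i : ℤ) : ℤ) : ℝ) ^ 2 = #F * 2 ^ Fintype.card ι := by
    exact_mod_cast sum_sq_signs F
  rw [card_signs, Nat.cast_pow, Nat.cast_ofNat, ← h, ← nsmul_eq_mul, ← sum_const]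
  refine (sum_le_sum fun b hb => ?_).trans
    (sum_le_sum_of_subset_of_nonneg (filter_subset _ _) fun b _ _ => sq_nonneg _)
  rw [← sq_abs ((∑ i ∈ F, (b i : ℤ) : ℤ) : ℝ)]
  exact pow_le_pow_left₀ ht.le (mem_filter.1 hb).2 2

theorem card_signs_count_eq (R : Finset ι) (j : ℕ) :
    #{b : ι → ℤˣ | #{i ∈ R | b i = 1} = j} * 2 ^ #R = (#R).choose j * 2 ^ Fintype.card ι := by
  induction R using Finset.induction_on generalizing j with
  | empty => cases j <;> simp
  | insert i R hi ih =>
    have h := sum_signs_flip i fun b : ι → ℤˣ =>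
      if #{u ∈ insert i R | b u = 1} = j then 1 else 0
    have hflip : ∀ b : ι → ℤˣ,
        #{u ∈ R | (b * Pi.mulSingle i (-1) : ι → ℤˣ) u = 1} = #{u ∈ R | b u = 1} :=
      fun b => congrArg card (filter_congr fun u hu => by rw [flip_apply_of_mem hi hu])
    have hins : ∀ b : ι → ℤˣ, #{u ∈ insert i R | b u = 1} =
        #{u ∈ R | b u = 1} + if b i = 1 then 1 else 0 := fun b => by
      rw [filter_insert]
      split_ifs with hb
      · rw [card_insert_of_notMem (by simp [hi])]
      · simp
    simp only [hins, hflip, flip_apply_self] at h ⊢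
    rw [card_filter, card_insert_of_notMem hi, pow_succ]
    have h2 : ∑ b : ι → ℤˣ,
          (if #{u ∈ R | b u = 1} + (if -b i = 1 then 1 else 0) = j then 1 else 0) +
        ∑ b : ι → ℤˣ, (if #{u ∈ R | b u = 1} + (if b i = 1 then 1 else 0) = j then 1 else 0) =
        ∑ b : ι → ℤˣ, ((if #{u ∈ R | b u = 1} = j then 1 else 0) +
          (if #{u ∈ R | b u = 1} + 1 = j then 1 else 0)) := by
      rw [← sum_add_distrib]
      refine sum_congr rfl fun b _ => ?_
      rcases Int.units_eq_one_or (b i) with hb | hb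
      · simp [hb, show (-1 : ℤˣ) ≠ 1 by decide]
      · simp [hb, show (-1 : ℤˣ) ≠ 1 by decide, add_comm]
    have ih' : ∀ k, (∑ b : ι → ℤˣ, if #{u ∈ R | b u = 1} = k then 1 else 0) * 2 ^ #R =
        (#R).choose k * 2 ^ Fintype.card ι := fun k => by rw [← card_filter, ih k]
    rw [h, ← two_mul, sum_add_distrib] at h2
    rw [mul_comm (2 ^ #R) 2, ← mul_assoc, mul_comm _ 2, h2, add_mul, ih' j]
    cases j with
    | zero => simp
    | succ j => simp only [add_left_inj, ih' j, Nat.choose_succ_succ]; ring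

omit [Fintype ι] [DecidableEq ι] in
theorem sum_signs_eq (R : Finset ι) (b : ι → ℤˣ) :
    ∑ i ∈ R, (b i : ℤ) = 2 * #{i ∈ R | b i = 1} - #R := by
  rw [card_filter, card_eq_sum_ones]
  push_cast
  rw [mul_sum, ← sum_sub_distrib]
  refine sum_congr rfl fun i _ => ?_
  rcases Int.units_eq_one_or (b i) with hb | hb <;>
    simp [hb, show (-1 : ℤˣ) ≠ 1 by decide]

theorem centralBinom_sq_mul_le (m : ℕ) : m.centralBinom ^ 2 * (2 * m + 1) ≤ 16 ^ m := by
  induction m with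
  | zero => simp
  | succ m ih =>
    have h := Nat.succ_mul_centralBinom_succ m
    have hpos : 0 < (m + 1) ^ 2 := by positivity
    refine Nat.le_of_mul_le_mul_left ?_ hpos
    calc (m + 1) ^ 2 * ((m + 1).centralBinom ^ 2 * (2 * (m + 1) + 1))
        = ((m + 1) * (m + 1).centralBinom) ^ 2 * (2 * m + 3) := by ring
      _ = 4 * ((2 * m + 1) * (2 * m + 3)) * (m.centralBinom ^ 2 * (2 * m + 1)) := by
          rw [h]; ring
      _ ≤ 4 * (4 * (m + 1) ^ 2) * 16 ^ m :=
          Nat.mul_le_mul (Nat.mul_le_mul_left 4 (by ring_nf; omega)) ih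
      _ = (m + 1) ^ 2 * 16 ^ (m + 1) := by ring

theorem choose_sq_mul_le (r j : ℕ) : r.choose j ^ 2 * r ≤ 4 ^ r := by
  have hj : r.choose j ≤ r.choose (r / 2) := Nat.choose_le_middle j r
  refine (Nat.mul_le_mul_right r (Nat.pow_le_pow_left hj 2)).trans ?_
  obtain ⟨m, rfl | rfl⟩ := Nat.even_or_odd' r
  · have h := centralBinom_sq_mul_le m
    rw [Nat.centralBinom] at h
    rw [Nat.mul_div_cancel_left m two_pos, pow_mul]
    norm_num
    nlinarith
  · have h := centralBinom_sq_mul_le (m + 1)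
    have h2 : (m + 1).centralBinom = 2 * (2 * m + 1).choose m := by
      rw [Nat.centralBinom, show 2 * (m + 1) = 2 * m + 1 + 1 by ring, Nat.choose_succ_succ,
        Nat.choose_symm_half m]
      ring
    rw [show (2 * m + 1) / 2 = m by omega, pow_succ 4, pow_mul]
    rw [h2, pow_succ 16] at h
    norm_num
    nlinarith [Nat.zero_le ((2 * m + 1).choose m ^ 2)]

theorem card_signs_sum_eq_le (R : Finset ι) (hR : R.Nonempty) (x : ℤ) :
    (#{b : ι → ℤˣ | ∑ i ∈ R, (b i : ℤ) = x} : ℝ) ≤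
      1 / √(#R) * Fintype.card (ι → ℤˣ) := by
  set j := ((x + #R) / 2).toNat
  have hsub : (#{b : ι → ℤˣ | ∑ i ∈ R, (b i : ℤ) = x} : ℝ) ≤
      #{b : ι → ℤˣ | #{i ∈ R | b i = 1} = j} := by
    norm_cast
    refine card_le_card fun b hb => ?_
    simp only [mem_filter, mem_univ, true_and, sum_signs_eq] at hb ⊢
    omega
  refine hsub.trans ?_
  have h : (#{b : ι → ℤˣ | #{i ∈ R | b i = 1} = j} : ℝ) * 2 ^ #R =
      (#R).choose j * 2 ^ Fintype.card ι := by exact_mod_cast card_signs_count_eq R j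
  have hr : (0 : ℝ) < √(#R) := Real.sqrt_pos.2 (by exact_mod_cast hR.card_pos)
  have hc : ((#R).choose j : ℝ) * √(#R) ≤ 2 ^ #R := by
    refine abs_le_of_sq_le_sq' ?_ (by positivity) |>.2
    rw [mul_pow, Real.sq_sqrt (by positivity), ← pow_mul, mul_comm (#R) 2, pow_mul]
    norm_num
    exact_mod_cast choose_sq_mul_le (#R) j
  rw [card_signs, one_div_mul_eq_div, le_div_iff₀ hr]
  push_cast
  have hp : (0 : ℝ) < 2 ^ #R := by positivity
  refine le_of_mul_le_mul_right ?_ hp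
  calc _ = ((#R).choose j * √(#R)) * 2 ^ Fintype.card ι := by
          rw [mul_right_comm, h]; ring
    _ ≤ 2 ^ #R * 2 ^ Fintype.card ι := by gcongr
    _ = _ := mul_comm _ _

/-- A sum of independent uniform signs puts little mass on short intervals. -/
theorem card_signs_abs_add_sum_le (R : Finset ι) (hR : R.Nonempty) (c : ℤ) (m : ℕ) :
    (#{b : ι → ℤˣ | |c + ∑ i ∈ R, (b i : ℤ)| ≤ m} : ℝ) ≤
      (2 * m + 1) / √(#R) * Fintype.card (ι → ℤˣ) := by
  have hsub : ({b : ι → ℤˣ | |c + ∑ i ∈ R, (b i : ℤ)| ≤ m} : Finset (ι → ℤˣ)) ⊆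
      (Icc (-m : ℤ) m).biUnion fun y => {b : ι → ℤˣ | ∑ i ∈ R, (b i : ℤ) = y - c} := by
    intro b hb
    simp only [mem_filter, mem_univ, true_and, mem_biUnion, mem_Icc] at hb ⊢
    exact ⟨c + ∑ i ∈ R, (b i : ℤ), abs_le.1 hb, by ring⟩
  calc (#{b : ι → ℤˣ | |c + ∑ i ∈ R, (b i : ℤ)| ≤ m} : ℝ)
      ≤ ∑ y ∈ Icc (-m : ℤ) m, (#{b : ι → ℤˣ | ∑ i ∈ R, (b i : ℤ) = y - c} : ℝ) := by
        exact_mod_cast (card_le_card hsub).trans card_biUnion_le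
    _ ≤ ∑ y ∈ Icc (-m : ℤ) m, 1 / √(#R) * (Fintype.card (ι → ℤˣ) : ℝ) :=
        sum_le_sum fun y _ => card_signs_sum_eq_le R hR _
    _ = _ := by
        have : #(Icc (-m : ℤ) m) = 2 * m + 1 := by rw [Int.card_Icc]; omega
        rw [sum_const, this, nsmul_eq_mul]
        push_cast
        ring

theorem card_signs_abs_le_abs (R F : Finset ι) (hR : R.Nonempty) (a : ι → ℤˣ) (c : ℤ) {m : ℕ}
    (hm : 0 < m) :
    (#{b : ι → ℤˣ | |c + ∑ i ∈ R, ((a i * b i : ℤˣ) : ℤ)| ≤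
        |∑ i ∈ F, ((a i * b i : ℤˣ) : ℤ)| + 2} : ℝ) ≤
      (#F / (m : ℝ) ^ 2 + (2 * m + 3) / √(#R)) * Fintype.card (ι → ℤˣ) := by
  have hshift : #{b : ι → ℤˣ | |c + ∑ i ∈ R, ((a i * b i : ℤˣ) : ℤ)| ≤
        |∑ i ∈ F, ((a i * b i : ℤˣ) : ℤ)| + 2} =
      #{b : ι → ℤˣ | |c + ∑ i ∈ R, (b i : ℤ)| ≤ |∑ i ∈ F, (b i : ℤ)| + 2} := by
    rw [card_filter, card_filter]
    exact Equiv.sum_comp (Equiv.mulLeft a) fun b : ι → ℤˣ =>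
      if |c + ∑ i ∈ R, (b i : ℤ)| ≤ |∑ i ∈ F, (b i : ℤ)| + 2 then 1 else 0
  have hsub : ({b : ι → ℤˣ | |c + ∑ i ∈ R, (b i : ℤ)| ≤ |∑ i ∈ F, (b i : ℤ)| + 2} :
      Finset (ι → ℤˣ)) ⊆
        univ.filter (fun b : ι → ℤˣ => (m : ℝ) ≤ |((∑ i ∈ F, (b i : ℤ) : ℤ) : ℝ)|) ∪
        univ.filter fun b : ι → ℤˣ => |c + ∑ i ∈ R, (b i : ℤ)| ≤ (m + 1 : ℕ) := by
    intro b hb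
    simp only [mem_union, mem_filter, mem_univ, true_and] at hb ⊢
    by_cases h : (m : ℤ) ≤ |∑ i ∈ F, (b i : ℤ)|
    · exact Or.inl (by exact_mod_cast h)
    · exact Or.inr (by push_cast; linarith [Int.not_le.1 h, Int.add_one_le_of_lt (Int.not_le.1 h)])
  have h1 := card_signs_sum_ge F (t := m) (by exact_mod_cast hm)
  have h2 := card_signs_abs_add_sum_le R hR c (m + 1)
  rw [hshift, add_mul]
  refine (Nat.cast_le.2 ((card_le_card hsub).trans (card_union_le _ _))).trans ?_
  push_cast at h1 h2 ⊢
  refine add_le_add h1 (h2.trans_eq ?_)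
  ring

end SignVectors

/-- If a property has density at most `p` along every orbit of a finite family of permutations,
then it has density at most `p`. -/
theorem card_filter_le_of_average {α κ : Type*} [Fintype α] [Fintype κ] [Nonempty κ]
    (T : κ → Equiv.Perm α) (P : α → Prop) [DecidablePred P] {p : ℝ}
    (h : ∀ a, (#{k | P (T k a)} : ℝ) ≤ p * Fintype.card κ) :
    (#{a | P a} : ℝ) ≤ p * Fintype.card α := by
  have hκ : (0 : ℝ) < Fintype.card κ := by exact_mod_cast Fintype.card_pos
  have hT : ∀ k, ∑ a, (if P (T k a) then (1 : ℝ) else 0) = #{a | P a} := fun k => by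
    rw [Equiv.sum_comp (T k) fun a => if P a then (1 : ℝ) else 0, sum_boole]
  refine le_of_mul_le_mul_left ?_ hκ
  calc (Fintype.card κ : ℝ) * #{a | P a}
      = ∑ k, ∑ a, (if P (T k a) then (1 : ℝ) else 0) := by simp [hT]
    _ = ∑ a, (#{k | P (T k a)} : ℝ) := by rw [sum_comm]; simp
    _ ≤ ∑ _a : α, p * Fintype.card κ := sum_le_sum fun a _ => h a
    _ = Fintype.card κ * (p * Fintype.card α) := by simp; ring

section Couplings

variable {V : Type*} [DecidableEq V]

/-- The symmetric sign matrix with zero diagonal attached to a graph: `1` on edges and `-1` on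
non-edges. -/
noncomputable def coupling (G : SimpleGraph V) (u v : V) : ℤ :=
  if u = v then 0 else if G.Adj u v then 1 else -1

/-- Multiply the coupling matrix of a graph entrywise by a symmetric sign matrix. -/
noncomputable def twist (M : V → V → ℤˣ) (hM : ∀ u v, M u v = M v u) :
    Equiv.Perm (SimpleGraph V) :=
  Function.Involutive.toPerm
    (fun G =>
      { Adj := fun u v => u ≠ v ∧ (G.Adj u v ↔ M u v = 1)
        symm := ⟨fun u v h => ⟨h.1.symm, by rw [G.adj_comm, ← hM]; exact h.2⟩⟩
        loopless := ⟨fun _ h => h.1 rfl⟩ })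
    (fun G => by
      ext u v
      have := G.ne_of_adj (a := u) (b := v)
      simp only
      tauto)

theorem coupling_self (G : SimpleGraph V) (v : V) : coupling G v v = 0 := by simp [coupling]

theorem coupling_comm (G : SimpleGraph V) (u v : V) : coupling G u v = coupling G v u := by
  simp [coupling, G.adj_comm, eq_comm]

theorem coupling_of_ne (G : SimpleGraph V) {u v : V} (h : u ≠ v) :
    coupling G u v = ((if G.Adj u v then 1 else -1 : ℤˣ) : ℤ) := by
  rw [coupling, if_neg h]
  split_ifs <;> rfl

theorem coupling_twist (M : V → V → ℤˣ) (hM : ∀ u v, M u v = M v u) (G : SimpleGraph V)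
    (u v : V) : coupling (twist M hM G) u v = M u v * coupling G u v := by
  have hadj : (twist M hM G).Adj u v ↔ u ≠ v ∧ (G.Adj u v ↔ M u v = 1) := Iff.rfl
  simp only [coupling, hadj]
  rcases Int.units_eq_one_or (M u v) with h | h <;> by_cases huv : u = v <;>
    by_cases hG : G.Adj u v <;> simp [h, huv, hG, show (-1 : ℤˣ) ≠ 1 by decide]

variable [Fintype V]

/-- No single spin flip increases the energy `∑ u v, coupling G u v * σ u * σ v`. -/
def IsStable (G : SimpleGraph V) (σ : V → ℤˣ) : Prop :=
  ∀ v, 0 ≤ (σ v : ℤ) * ∑ u, coupling G u v * σ u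

theorem energy_flip (G : SimpleGraph V) (x : V → ℤ) (w : V) :
    ∑ v, (x v - if v = w then 2 * x w else 0) *
        ∑ u, coupling G u v * (x u - if u = w then 2 * x w else 0) =
      ∑ v, x v * ∑ u, coupling G u v * x u - 4 * (x w * ∑ u, coupling G u w * x u) := by
  have h : ∀ v, ∑ u, coupling G u v * (x u - if u = w then 2 * x w else 0) =
      ∑ u, coupling G u v * x u - 2 * x w * coupling G v w := fun v => by
    simp only [mul_sub, sum_sub_distrib, mul_ite, mul_zero, sum_ite_eq', mem_univ, if_true]
    rw [coupling_comm G w v]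
    ring
  simp only [h]
  simp only [sub_mul, mul_sub, sum_sub_distrib, ite_mul, zero_mul, sum_ite_eq', mem_univ,
    if_true, coupling_self]
  have h2 : ∑ v, x v * (2 * x w * coupling G v w) = 2 * (x w * ∑ u, coupling G u w * x u) := by
    rw [mul_sum, mul_sum]
    exact sum_congr rfl fun v _ => by ring
  rw [h2]
  ring

theorem exists_isStable (G : SimpleGraph V) : ∃ σ, IsStable G σ := by
  obtain ⟨σ, hσ⟩ := Finite.exists_max fun σ : V → ℤˣ =>
    ∑ v, (σ v : ℤ) * ∑ u, coupling G u v * σ u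
  refine ⟨σ, fun w => ?_⟩
  have h := hσ (σ * Pi.mulSingle w (-1))
  have hflip : ∀ v, (((σ * Pi.mulSingle w (-1) : V → ℤˣ) v : ℤˣ) : ℤ) =
      (σ v : ℤ) - if v = w then 2 * (σ w : ℤ) else 0 := fun v => by
    by_cases hv : v = w
    · subst hv; simp; ring
    · simp [hv]
  simp only [hflip, energy_flip G fun v => (σ v : ℤ)] at h
  linarith

theorem IsStable.twist {G : SimpleGraph V} {σ : V → ℤˣ} (h : IsStable G σ) (τ : V → ℤˣ) :
    IsStable (twist (fun u v => τ u * τ v) (fun u v => mul_comm (τ u) (τ v)) G) (τ * σ) := by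
  intro v
  refine (h v).trans_eq ?_
  have hsq : ∀ u, (τ u : ℤ) * τ u = 1 := fun u => by
    rw [← Units.val_mul, Int.units_mul_self, Units.val_one]
  rw [mul_sum, mul_sum]
  refine sum_congr rfl fun u _ => ?_
  rw [coupling_twist]
  simp only [Pi.mul_apply, Units.val_mul]
  linear_combination (-(σ v : ℤ) * coupling G u v * σ u) * (hsq u) * ((τ v : ℤ) * τ v) -
    (σ v : ℤ) * coupling G u v * σ u * hsq v

/-- By gauge symmetry, most graphs have a nearly balanced local maximum. -/
theorem card_no_balanced_isStable_le {t : ℝ} (ht : 0 < t) :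
    (#{G : SimpleGraph V | ¬∃ σ, IsStable G σ ∧ |((∑ v, (σ v : ℤ) : ℤ) : ℝ)| < t} : ℝ) ≤
      Fintype.card V / t ^ 2 * Fintype.card (SimpleGraph V) := by
  refine card_filter_le_of_average
    (fun τ : V → ℤˣ => twist (fun u v => τ u * τ v) fun u v => mul_comm (τ u) (τ v)) _
    fun G => ?_
  obtain ⟨σ, hσ⟩ := exists_isStable G
  have hcheb := card_signs_sum_ge (univ : Finset V) ht
  rw [card_univ] at hcheb
  refine le_trans ?_ hcheb
  norm_cast
  refine card_le_card_of_injOn (fun τ => τ * σ) (fun τ hτ => ?_)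
    ((mul_left_injective σ).injOn)
  simp only [coe_filter, mem_univ, true_and, Set.mem_ofPred_eq, not_exists, not_and,
    not_lt] at hτ ⊢
  exact hτ _ (hσ.twist τ)

/-- The symmetric sign matrix with entries from `B` on pairs between `S` and its complement and
ones elsewhere. -/
def crossSigns (S : Finset V) (B : V → V → ℤˣ) (u v : V) : ℤˣ :=
  (if v ∈ S ∧ u ∉ S then B v u else 1) * if u ∈ S ∧ v ∉ S then B u v else 1

omit [Fintype V] in
theorem crossSigns_comm (S : Finset V) (B : V → V → ℤˣ) (u v : V) :
    crossSigns S B u v = crossSigns S B v u := mul_comm _ _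

omit [Fintype V] in
theorem crossSigns_of_notMem {S : Finset V} (B : V → V → ℤˣ) {u v : V} (hv : v ∈ S)
    (hu : u ∉ S) : crossSigns S B u v = B v u := by simp [crossSigns, hu, hv]

omit [Fintype V] in
theorem crossSigns_of_mem {S : Finset V} (B : V → V → ℤˣ) {u v : V} (hv : v ∈ S)
    (hu : u ∈ S) : crossSigns S B u v = 1 := by simp [crossSigns, hu, hv]

/-- At every vertex of `S`, the contribution of the vertices outside `F` to the local field is
bounded by the contribution of `F`, up to an additive constant. -/
def FieldsDominated (G : SimpleGraph V) (σ : V → ℤˣ) (F S : Finset V) : Prop :=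
  ∀ v ∈ S, |∑ u ∈ Fᶜ, coupling G u v * σ u| ≤ |∑ u ∈ F, coupling G u v * σ u| + 2

/-- For fixed spins `σ`, it is very unlikely that the field of every vertex of `S` is dominated
by the contribution of `F`. -/
theorem card_fields_dominated_le (σ : V → ℤˣ) {F S : Finset V} (hFS : Disjoint S F)
    (hR : ((S ∪ F)ᶜ).Nonempty) {m : ℕ} (hm : 0 < m) {q : ℝ}
    (hq : #F / (m : ℝ) ^ 2 + (2 * m + 3) / √(#(S ∪ F)ᶜ) ≤ q) :
    (#{G : SimpleGraph V | FieldsDominated G σ F S} : ℝ) ≤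
      q ^ #S * Fintype.card (SimpleGraph V) := by
  refine card_filter_le_of_average (κ := V → V → ℤˣ)
    (fun B => twist (crossSigns S B) (crossSigns_comm S B)) _ fun G => ?_
  set a : V → V → ℤˣ := fun v u => (if G.Adj u v then 1 else -1) * σ u
  set c : V → ℤ := fun v => ∑ u ∈ S, coupling G u v * σ u
  set Q : V → Finset (V → ℤˣ) := fun v =>
    {b | |c v + ∑ u ∈ (S ∪ F)ᶜ, ((a v u * b u : ℤˣ) : ℤ)| ≤
      |∑ u ∈ F, ((a v u * b u : ℤˣ) : ℤ)| + 2}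
  have hsub : ∀ B : V → V → ℤˣ,
      FieldsDominated (twist (crossSigns S B) (crossSigns_comm S B) G) σ F S →
      B ∈ Fintype.piFinset fun v => if v ∈ S then Q v else univ := by
    intro B hB
    rw [Fintype.mem_piFinset]
    intro v
    split_ifs with hv
    swap
    · exact mem_univ _
    have hout : ∀ u, u ∉ S →
        coupling (twist (crossSigns S B) (crossSigns_comm S B) G) u v * σ u =
        ((a v u * B v u : ℤˣ) : ℤ) := fun u hu => by
      have huv : u ≠ v := by rintro rfl; exact hu hv
      rw [coupling_twist, coupling_of_ne G huv, crossSigns_of_notMem B hv hu]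
      simp only [a, Units.val_mul]
      ring
    have hin : ∀ u ∈ S,
        coupling (twist (crossSigns S B) (crossSigns_comm S B) G) u v * σ u =
        coupling G u v * σ u := fun u hu => by
      rw [coupling_twist, crossSigns_of_mem B hv hu, Units.val_one, one_mul]
    have hcompl : Fᶜ = S ∪ (S ∪ F)ᶜ := by
      ext u
      have : u ∈ S → u ∉ F := fun h => Finset.disjoint_left.1 hFS h
      simp only [mem_compl, mem_union]
      tauto
    have hd : Disjoint S (S ∪ F)ᶜ :=
      Finset.disjoint_left.2 fun _ hu h => (Finset.mem_compl.1 h) (mem_union_left _ hu)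
    have hdom := hB v hv
    rw [sum_congr rfl fun u hu => hout u fun h => Finset.disjoint_left.1 hFS h hu, hcompl,
      sum_union hd, sum_congr rfl hin, sum_congr (s₁ := (S ∪ F)ᶜ) rfl fun u hu =>
        hout u fun h => (Finset.mem_compl.1 hu) (mem_union_left _ h)] at hdom
    exact mem_filter.2 ⟨mem_univ _, hdom⟩
  have hQ : ∀ v, (#(Q v) : ℝ) ≤ q * Fintype.card (V → ℤˣ) := fun v =>
    (card_signs_abs_le_abs _ F hR (a v) (c v) hm).trans (by gcongr)
  have hprod : ∏ v : V, (#(if v ∈ S then Q v else univ) : ℝ) ≤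
      ∏ v : V, (if v ∈ S then q else 1) * (Fintype.card (V → ℤˣ) : ℝ) := by
    refine prod_le_prod (fun _ _ => Nat.cast_nonneg _) fun v _ => ?_
    split_ifs
    · exact hQ v
    · simp
  refine (Nat.cast_le.2 (card_le_card fun B hB => hsub B (mem_filter.1 hB).2)).trans ?_
  rw [Fintype.card_piFinset, Nat.cast_prod]
  refine hprod.trans_eq ?_
  rw [prod_mul_distrib, prod_ite_mem, univ_inter, prod_const, prod_const, card_univ,
    Fintype.card_fun (β := V → ℤˣ)]
  push_cast
  rfl

end Couplings

theorem degIn_sub_degIn_compl {n : ℕ} (G : SimpleGraph (Fin n)) (s : Fin n → ℤˣ) (v : Fin n) :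
    2 * ((degIn G {u | s u = 1} v : ℤ) - degIn G ({u | s u = 1} : Finset (Fin n))ᶜ v) =
      ∑ u, coupling G u v * s u + ∑ u, (s u : ℤ) - s v := by
  have hv : (s v : ℤ) = ∑ u, if u = v then (s u : ℤ) else 0 := by simp
  have h1 : (degIn G {u | s u = 1} v : ℤ) = ∑ u, if s u = 1 ∧ G.Adj v u then 1 else 0 := by
    rw [degIn, filter_filter, card_filter]
    push_cast
    rfl
  have h2 : (degIn G ({u | s u = 1} : Finset (Fin n))ᶜ v : ℤ) =
      ∑ u, if ¬s u = 1 ∧ G.Adj v u then 1 else 0 := by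
    rw [degIn, compl_filter, filter_filter, card_filter]
    push_cast
    rfl
  rw [h1, h2, hv, ← sum_sub_distrib, ← sum_add_distrib, ← sum_sub_distrib, mul_sum]
  refine sum_congr rfl fun u _ => ?_
  rw [coupling, G.adj_comm]
  have hirr := G.ne_of_adj (a := u) (b := v)
  rcases Int.units_eq_one_or (s u) with h | h <;> by_cases huv : u = v <;>
    by_cases hG : G.Adj u v <;> simp_all [show (-1 : ℤˣ) ≠ 1 by decide]

theorem two_mul_friendliness {n : ℕ} (G : SimpleGraph (Fin n)) (s : Fin n → ℤˣ) (v : Fin n) :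
    2 * friendliness G {u | s u = 1} v =
      s v * ∑ u, coupling G u v * s u + s v * ∑ u, (s u : ℤ) - 1 := by
  have h := degIn_sub_degIn_compl G s v
  rw [friendliness]
  rcases Int.units_eq_one_or (s v) with hv | hv <;>
    simp only [mem_filter, mem_univ, true_and, hv, if_true, show (-1 : ℤˣ) ≠ 1 by decide,
      if_false, Units.val_neg, Units.val_one] at h ⊢ <;> linarith

theorem isBisection_of_abs_sum_le {n : ℕ} (s : Fin n → ℤˣ) (h : |∑ u, (s u : ℤ)| ≤ 1) :
    IsBisection ({u | s u = 1} : Finset (Fin n)) := by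
  rw [IsBisection]
  convert h using 2
  rw [sum_signs_eq univ s, card_compl, Nat.cast_sub (card_le_univ _), card_univ]
  ring

/-- Sign vectors can be balanced by flipping at most half as many signs as the discrepancy. -/
theorem exists_balancing_flip {V : Type*} [Fintype V] [DecidableEq V] (σ : V → ℤˣ) :
    ∃ F : Finset V, (#F : ℤ) ≤ |∑ u, (σ u : ℤ)| ∧
      |∑ u, (((if u ∈ F then -σ u else σ u) : ℤˣ) : ℤ)| ≤ 1 := by
  have key : ∀ e : ℤˣ, 0 ≤ e * ∑ u, (σ u : ℤ) → ∃ F : Finset V,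
      (#F : ℤ) ≤ |∑ u, (σ u : ℤ)| ∧
      |∑ u, (((if u ∈ F then -σ u else σ u) : ℤˣ) : ℤ)| ≤ 1 := by
    intro e he
    have hee : (e : ℤ) * e = 1 := by rw [← Units.val_mul, Int.units_mul_self, Units.val_one]
    set x := (e : ℤ) * ∑ u, (σ u : ℤ) with hx
    have hxle : x ≤ #{u | σ u = e} := by
      rw [hx, mul_sum, card_filter]
      push_cast
      refine sum_le_sum fun u _ => ?_
      rcases Int.units_eq_one_or (σ u) with h | h <;>
        rcases Int.units_eq_one_or e with h' | h' <;> simp [h, h', show (-1 : ℤˣ) ≠ 1 by decide]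
    obtain ⟨F, hF, hcard⟩ := exists_subset_card_eq
      (show (x / 2).toNat ≤ #{u | σ u = e} by omega)
    have he1 : |(e : ℤ)| = 1 := by rcases Int.units_eq_one_or e with h | h <;> simp [h]
    have habs : |∑ u, (σ u : ℤ)| = x := by
      rw [← abs_of_nonneg he, hx, abs_mul, he1, one_mul]
    have hsum : ∑ u, (((if u ∈ F then -σ u else σ u) : ℤˣ) : ℤ) = e * (x - 2 * #F) := by
      have h1 : ∀ u, (((if u ∈ F then -σ u else σ u) : ℤˣ) : ℤ) =
          σ u - if u ∈ F then 2 * (e : ℤ) else 0 := fun u => by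
        split_ifs with hu
        · rw [← (mem_filter.1 (hF hu)).2, Units.val_neg]; ring
        · ring
      simp only [h1, sum_sub_distrib, sum_ite_mem, univ_inter, sum_const, nsmul_eq_mul]
      linear_combination (-∑ u, (σ u : ℤ)) * hee
    refine ⟨F, by omega, ?_⟩
    rw [hsum, abs_mul, he1, one_mul, abs_le]
    omega
  rcases le_total 0 (∑ u, (σ u : ℤ)) with h | h
  · exact key 1 (by simpa using h)
  · exact key (-1) (by simpa using h)

theorem not_friendly_of_balanced {n : ℕ} {G : SimpleGraph (Fin n)} {σ : Fin n → ℤˣ}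
    (hσ : IsStable G σ) {F : Finset (Fin n)}
    (hF : |∑ u, (((if u ∈ F then -σ u else σ u) : ℤˣ) : ℤ)| ≤ 1) {v : Fin n} (hv : v ∉ F)
    (hunf : ¬0 < friendliness G {u | (if u ∈ F then -σ u else σ u) = 1} v) :
    |∑ u ∈ Fᶜ, coupling G u v * σ u| ≤ |∑ u ∈ F, coupling G u v * σ u| + 2 := by
  have h := two_mul_friendliness G (fun u => if u ∈ F then -σ u else σ u) v
  have hst := hσ v
  have h1 : ∑ u, coupling G u v * (((if u ∈ F then -σ u else σ u) : ℤˣ) : ℤ) =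
      ∑ u ∈ Fᶜ, coupling G u v * σ u - ∑ u ∈ F, coupling G u v * σ u := by
    rw [← sum_add_sum_compl F, sub_eq_neg_add, ← sum_neg_distrib]
    refine congrArg₂ _ (sum_congr rfl fun u hu => ?_) (sum_congr rfl fun u hu => ?_)
    · simp [hu]
    · simp [Finset.mem_compl.1 hu]
  rw [h1] at h
  rw [← sum_add_sum_compl F] at hst
  simp only [if_neg hv] at h
  set X := ∑ u ∈ Fᶜ, coupling G u v * (σ u : ℤ)
  set Y := ∑ u ∈ F, coupling G u v * (σ u : ℤ)
  have hY := abs_le.1 (le_refl |Y|)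
  have hs := abs_le.1 hF
  rw [abs_le]
  rcases Int.units_eq_one_or (σ v) with hv1 | hv1 <;>
    simp only [hv1, Units.val_neg, Units.val_one] at h hst <;> constructor <;> linarith

/-- A nearly balanced stable spin configuration yields a friendly bisection, unless the fields of
many vertices are dominated by the contribution of a small set. -/
theorem IsStable.exists_friendly_bisection {n : ℕ} {G : SimpleGraph (Fin n)} {σ : Fin n → ℤˣ}
    (hσ : IsStable G σ) {t : ℝ} (hbal : |((∑ v, (σ v : ℤ) : ℤ) : ℝ)| < t) {s : ℕ}
    (hdom : ∀ F S : Finset (Fin n), #F ≤ t → #S = s → Disjoint S F →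
      ¬FieldsDominated G σ F S) :
    ∃ A : Finset (Fin n), IsBisection A ∧
      n - t - s ≤ (#{v | 0 < friendliness G A v} : ℝ) := by
  obtain ⟨F, hFcard, hF⟩ := exists_balancing_flip σ
  have hFt : (#F : ℝ) ≤ t := by
    refine le_trans ?_ hbal.le
    exact_mod_cast hFcard
  refine ⟨_, isBisection_of_abs_sum_le _ hF, ?_⟩
  set A : Finset (Fin n) := {u | (if u ∈ F then -σ u else σ u) = 1} with hA
  set U : Finset (Fin n) := {v | v ∉ F ∧ ¬0 < friendliness G A v} with hU
  have hUs : #U < s := by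
    by_contra! hle
    obtain ⟨S, hSU, hS⟩ := exists_subset_card_eq hle
    refine hdom F S hFt hS
      (Finset.disjoint_left.2 fun v hv => (mem_filter.1 (hSU hv)).2.1) fun v hv => ?_
    obtain ⟨-, hvF, hunf⟩ := mem_filter.1 (hSU hv)
    exact not_friendly_of_balanced hσ hF hvF hunf
  have hcover : (univ : Finset (Fin n)) ⊆
      (univ.filter fun v => 0 < friendliness G A v) ∪ (F ∪ U) := by
    intro v _
    simp only [hU, mem_union, mem_filter, mem_univ, true_and]
    tauto
  have hn : n ≤ #{v | 0 < friendliness G A v} + (#F + #U) := by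
    have := (card_le_card hcover).trans ((card_union_le _ _).trans
      (Nat.add_le_add_left (card_union_le _ _) _))
    rwa [card_univ, Fintype.card_fin] at this
  have hn' : (n : ℝ) ≤ #{v | 0 < friendliness G A v} + (#F + #U) := by exact_mod_cast hn
  have hU' : (#U : ℝ) ≤ s := by exact_mod_cast hUs.le
  linarith

theorem graphProb_le_card_div {n : ℕ} {P : SimpleGraph (Fin n) → Prop}
    {E : Finset (SimpleGraph (Fin n))} (h : ∀ G, P G → G ∈ E) :
    graphProb n P ≤ #E / Fintype.card (SimpleGraph (Fin n)) := by
  rw [graphProb]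
  gcongr
  exact fun G hG => h G (mem_filter.1 hG).2

/-- Quantitative form: up to an explicit failure probability, there is a bisection in which all but
`t + s` vertices are friendly. -/
theorem graphProb_no_friendly_bisection_le {n : ℕ} {t q : ℝ} (ht : 0 < t) {m s : ℕ}
    (hm : 0 < m) (hq0 : 0 ≤ q)
    (hq : ∀ F S : Finset (Fin n), #F ≤ t → #S = s → (S ∪ F)ᶜ.Nonempty ∧
      #F / (m : ℝ) ^ 2 + (2 * m + 3) / √(#(S ∪ F)ᶜ) ≤ q) :
    graphProb n (fun G => ¬∃ A : Finset (Fin n), IsBisection A ∧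
        n - t - s ≤ (#{v | 0 < friendliness G A v} : ℝ)) ≤ n / t ^ 2 + 8 ^ n * q ^ s := by
  have hpos : (0 : ℝ) < Fintype.card (SimpleGraph (Fin n)) := by exact_mod_cast Fintype.card_pos
  set T : Finset ((Fin n → ℤˣ) × Finset (Fin n) × Finset (Fin n)) :=
    {x | #x.2.1 ≤ t ∧ #x.2.2 = s ∧ Disjoint x.2.2 x.2.1}
  set E : (Fin n → ℤˣ) × Finset (Fin n) × Finset (Fin n) → Finset (SimpleGraph (Fin n)) :=
    fun x => {G | FieldsDominated G x.1 x.2.1 x.2.2}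
  set N : Finset (SimpleGraph (Fin n)) :=
    {G | ¬∃ σ, IsStable G σ ∧ |((∑ v, (σ v : ℤ) : ℤ) : ℝ)| < t} with hN
  have hsub : ∀ G : SimpleGraph (Fin n), (¬∃ A : Finset (Fin n), IsBisection A ∧
      n - t - s ≤ (#{v | 0 < friendliness G A v} : ℝ)) → G ∈ N ∪ T.biUnion E := by
    intro G hG
    by_contra hcon
    rw [mem_union, not_or, mem_biUnion] at hcon
    obtain ⟨hGN, hGE⟩ := hcon
    rw [hN, mem_filter, not_and_not_right] at hGN
    obtain ⟨σ, hσ, hbal⟩ := hGN (mem_univ _)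
    refine hG (hσ.exists_friendly_bisection hbal fun F S hF hS hd h => hGE ⟨(σ, F, S), ?_, ?_⟩)
    · exact mem_filter.2 ⟨mem_univ _, hF, hS, hd⟩
    · exact mem_filter.2 ⟨mem_univ _, h⟩
  have hTcard : (#T : ℝ) ≤ 8 ^ n := by
    refine (Nat.cast_le.2 (card_le_univ T)).trans_eq ?_
    rw [Fintype.card_prod, Fintype.card_prod, card_signs, Fintype.card_finset, Fintype.card_fin]
    push_cast
    rw [← mul_pow, ← mul_pow]
    norm_num
  have hEcard : ∀ x ∈ T, (#(E x) : ℝ) ≤ q ^ s * Fintype.card (SimpleGraph (Fin n)) := by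
    rintro ⟨σ, F, S⟩ hx
    obtain ⟨-, hFt, rfl, hd⟩ := mem_filter.1 hx
    obtain ⟨hR, hq⟩ := hq F S hFt rfl
    exact card_fields_dominated_le σ hd hR hm hq
  have hNcard : (#N : ℝ) ≤ n / t ^ 2 * Fintype.card (SimpleGraph (Fin n)) := by
    have h := card_no_balanced_isStable_le (V := Fin n) ht
    rw [Fintype.card_fin] at h
    exact h
  refine (graphProb_le_card_div hsub).trans ((div_le_iff₀ hpos).2 ?_)
  have hunion : #(N ∪ T.biUnion E) ≤ #N + ∑ x ∈ T, #(E x) :=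
    (card_union_le _ _).trans (Nat.add_le_add_left card_biUnion_le _)
  calc (#(N ∪ T.biUnion E) : ℝ) ≤ #N + ∑ x ∈ T, (#(E x) : ℝ) := by exact_mod_cast hunion
    _ ≤ n / t ^ 2 * Fintype.card (SimpleGraph (Fin n)) +
        ∑ _x ∈ T, q ^ s * (Fintype.card (SimpleGraph (Fin n)) : ℝ) :=
        add_le_add hNcard (sum_le_sum hEcard)
    _ ≤ (n / t ^ 2 + 8 ^ n * q ^ s) * Fintype.card (SimpleGraph (Fin n)) := by
        rw [sum_const, nsmul_eq_mul, add_mul, mul_assoc (8 ^ n)]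
        gcongr

theorem graphProb_mono (n : ℕ) {P Q : SimpleGraph (Fin n) → Prop} (h : ∀ G, P G → Q G) :
    graphProb n P ≤ graphProb n Q := by
  rw [graphProb, graphProb]
  gcongr with G
  exact h G

theorem graphProb_le_one (n : ℕ) (P : SimpleGraph (Fin n) → Prop) : graphProb n P ≤ 1 :=
  div_le_one_of_le₀ (by exact_mod_cast card_le_univ _) (by positivity)

theorem graphProb_eq_one_sub (n : ℕ) (P : SimpleGraph (Fin n) → Prop) :
    graphProb n P = 1 - graphProb n fun G => ¬P G := by
  have hpos : (0 : ℝ) < Fintype.card (SimpleGraph (Fin n)) := by exact_mod_cast Fintype.card_pos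
  have h := card_filter_add_card_filter_not (s := (univ : Finset (SimpleGraph (Fin n)))) P
  rw [card_univ] at h
  rw [graphProb, graphProb, eq_sub_iff_add_eq, ← add_div, div_eq_one_iff_eq hpos.ne']
  norm_cast
  convert h

theorem graphProb_no_friendly_bisection_le_of_large {n : ℕ} (hn : 0 < n) {η : ℝ} (hη0 : 0 < η)
    (hη1 : η ≤ 1 / 4) (hηn : 10 ≤ η * √n) {s : ℕ} (hs : (s : ℝ) ≤ n / 2) :
    graphProb n (fun G => ¬∃ A : Finset (Fin n), IsBisection A ∧
        n - η ^ 3 * n - s ≤ (#{v | 0 < friendliness G A v} : ℝ)) ≤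
      1 / η ^ 6 / n + 8 ^ n * (6 * η) ^ s := by
  have hn0 : (0 : ℝ) < n := by exact_mod_cast hn
  have hsq : √(n : ℝ) ^ 2 = n := Real.sq_sqrt hn0.le
  have hsqrt : 0 < √(n : ℝ) := Real.sqrt_pos.2 hn0
  have hη3 : η ^ 3 ≤ 1 / 4 := by nlinarith [sq_nonneg η]
  have hx : 0 < η * √n := by positivity
  have h := graphProb_no_friendly_bisection_le (n := n) (t := η ^ 3 * n) (q := 6 * η)
    (m := ⌈η * √n⌉₊) (s := s) (by positivity) (Nat.ceil_pos.2 hx) (by positivity) ?_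
  · refine h.trans_eq ?_
    congr 1
    field_simp
  intro F S hF hS
  have hSF : (n : ℝ) / 4 ≤ #(S ∪ F)ᶜ := by
    have h1 : n ≤ #(S ∪ F)ᶜ + (s + #F) := by
      have := card_union_le S F
      have h2 := card_compl (S ∪ F)
      rw [Fintype.card_fin] at h2
      omega
    have h2 : (n : ℝ) ≤ #(S ∪ F)ᶜ + (s + #F) := by exact_mod_cast h1
    nlinarith
  have hcard : (0 : ℝ) < #(S ∪ F)ᶜ := by linarith
  refine ⟨card_pos.1 (by exact_mod_cast hcard), ?_⟩
  have hroot : √(n : ℝ) / 2 ≤ √(#(S ∪ F)ᶜ) := by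
    refine Real.le_sqrt_of_sq_le ?_
    rw [div_pow, hsq]
    linarith
  have hm1 := Nat.le_ceil (η * √n)
  have hm2 := (Nat.ceil_lt_add_one hx.le).le
  have h1 : #F / (⌈η * √n⌉₊ : ℝ) ^ 2 ≤ η := by
    calc #F / (⌈η * √n⌉₊ : ℝ) ^ 2 ≤ η ^ 3 * n / (η * √n) ^ 2 := by gcongr
      _ = η := by rw [mul_pow, hsq]; field_simp
  have h2 : (2 * (⌈η * √n⌉₊ : ℝ) + 3) / √(#(S ∪ F)ᶜ) ≤ 5 * η := by
    calc (2 * (⌈η * √n⌉₊ : ℝ) + 3) / √(#(S ∪ F)ᶜ)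
        ≤ (2 * (η * √n + 1) + 3) / (√n / 2) := by gcongr
      _ ≤ 5 * η := by
        rw [div_le_iff₀ (by positivity)]
        linarith
  linarith

theorem tendsto_one_sub_div_add_pow (C : ℝ) :
    Tendsto (fun n : ℕ => 1 - (C / n + (1 / 2 : ℝ) ^ n)) atTop (nhds 1) := by
  have h := (tendsto_const_nhds (x := (1 : ℝ))).sub
    ((tendsto_const_div_atTop_nhds_zero_nat C).add
      (tendsto_pow_atTop_nhds_zero_of_lt_one (r := (1 / 2 : ℝ)) (by norm_num) (by norm_num)))
  rwa [add_zero, sub_zero] at h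

/-- for every `ε > 0`, with probability tending to `1`, `G(n,1/2)` admits a
bisection in which at least `(1-ε)n` vertices are friendly. -/
theorem statement0 (ε : ℝ) (hε : 0 < ε) :
    Tendsto (fun n : ℕ => graphProb n (fun G => ∃ A : Finset (Fin n), IsBisection A ∧
        (1 - ε) * n ≤ ((univ.filter fun v => 0 < friendliness G A v).card : ℝ)))
      atTop (nhds 1) := by
  wlog hε1 : ε ≤ 1 generalizing ε
  · refine tendsto_of_tendsto_of_tendsto_of_le_of_le (this 1 one_pos le_rfl) tendsto_const_nhds
      (fun n => graphProb_mono n fun G => ?_) fun n => ?_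
    · rintro ⟨A, hA, h⟩
      refine ⟨A, hA, le_trans ?_ h⟩
      gcongr
      exact (not_le.1 hε1).le
    · exact graphProb_le_one _ _
  obtain ⟨K, hK⟩ := exists_nat_ge (4 / ε)
  have hK4 : (4 : ℝ) ≤ K := le_trans (by rw [le_div_iff₀ hε]; linarith) hK
  have hK0 : 0 < K := by
    have : (0 : ℝ) < K := by linarith
    exact_mod_cast this
  obtain ⟨η, hη0, hηε, hηK⟩ : ∃ η : ℝ, 0 < η ∧ η ≤ ε / 2 ∧ 6 * η ≤ (1 / 16) ^ K := by
    refine ⟨min ((1 / 16) ^ K / 6) (ε / 2), by positivity, min_le_right _ _, ?_⟩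
    linarith [min_le_left (((1 : ℝ) / 16) ^ K / 6) (ε / 2)]
  have hη1 : η ≤ 1 / 4 := by
    have : ((1 : ℝ) / 16) ^ K ≤ 1 := pow_le_one₀ (by norm_num) (by norm_num)
    linarith
  have hη3 : η ^ 3 ≤ ε / 2 := by
    refine le_trans ?_ hηε
    nlinarith [sq_nonneg η]
  have hlarge : Tendsto (fun n : ℕ => η * √(n : ℝ)) atTop atTop :=
    (Real.tendsto_sqrt_atTop.comp tendsto_natCast_atTop_atTop).const_mul_atTop hη0
  refine tendsto_of_tendsto_of_tendsto_of_le_of_le' (tendsto_one_sub_div_add_pow (1 / η ^ 6))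
    tendsto_const_nhds ?_ (Eventually.of_forall fun n => graphProb_le_one _ _)
  filter_upwards [hlarge.eventually_ge_atTop 10, eventually_gt_atTop 0,
    eventually_ge_atTop K] with n hn10 hn0 hnK
  set s : ℕ := n / K + 1 with hs
  have hnR : (0 : ℝ) < n := by exact_mod_cast hn0
  have hnKR : (K : ℝ) ≤ n := by exact_mod_cast hnK
  have hdiv : ((n / K : ℕ) : ℝ) ≤ n / K := Nat.cast_div_le
  have hεn : (n : ℝ) / K ≤ ε * n / 4 := by
    rw [div_le_iff₀ (by linarith)]
    rw [div_le_iff₀ hε] at hK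
    nlinarith
  have hone : (1 : ℝ) ≤ ε * n / 4 := le_trans (by rw [le_div_iff₀ (by linarith)]; linarith) hεn
  have hsε : (s : ℝ) ≤ ε * n / 2 := by
    rw [hs]
    push_cast
    linarith
  have hsn : (s : ℝ) ≤ n / 2 := hsε.trans (by nlinarith)
  have hKs : n ≤ K * s := by
    rw [hs]
    exact (Nat.lt_mul_div_succ n hK0).le
  have hpow : (8 : ℝ) ^ n * (6 * η) ^ s ≤ (1 / 2) ^ n := by
    calc (8 : ℝ) ^ n * (6 * η) ^ s ≤ 8 ^ n * ((1 / 16) ^ K) ^ s := by gcongr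
      _ ≤ 8 ^ n * (1 / 16) ^ n := by
        rw [← pow_mul]
        gcongr ?_ * ?_
        exact pow_le_pow_of_le_one (by norm_num) (by norm_num) hKs
      _ = (1 / 2) ^ n := by rw [← mul_pow]; norm_num
  have hmain := graphProb_no_friendly_bisection_le_of_large hn0 hη0 hη1 hn10 hsn
  calc 1 - (1 / η ^ 6 / n + (1 / 2 : ℝ) ^ n)
      ≤ graphProb n (fun G => ∃ A : Finset (Fin n), IsBisection A ∧
        n - η ^ 3 * n - s ≤ (#{v | 0 < friendliness G A v} : ℝ)) := by
        rw [graphProb_eq_one_sub]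
        linarith
    _ ≤ _ := by
      refine graphProb_mono n fun G => ?_
      rintro ⟨A, hA, h⟩
      refine ⟨A, hA, le_trans ?_ h⟩
      nlinarith
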